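/- Suppose a_{c·e_k} ≠ 0 for some k ∈ {1,…,d}, and let ν be the graded lexicographic monomial ordering in which multi-indices are compared first by total degree and, within equal total degree, in such a way that the k-th coordinate varies slowest (so that among the multi-indices of total degree c, the multi-index c·e_k comes last). Then ν(h(1)) = c·e_k; the set of unrepresented multi-indices {ν(h(1)),…,ν(h(N(p−c)))} equals {m ∈ M(p) : m_k ≥ c}; and consequently every represented index s ∈ j satisfies ν(s)_k ≤ c − 1. -/

import Mathlib

open scoped BigOperators

def Mfin (d t : ℕ) : Finset (Fin d → ℕ) :=
  (Fintype.piFinset fun _ : Fin d => Finset.range (t + 1)).filter fun q => ∑ i, q i ≤ t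

def Nc (d t : ℕ) : ℕ := (Mfin d t).card

structure GradedOrdering (d : ℕ) where
  toEquiv : ℕ+ ≃ (Fin d → ℕ)
  map_one : toEquiv 1 = 0
  graded : ∀ i j : ℕ+, (∑ k, toEquiv i k) < (∑ k, toEquiv j k) → i < j
  compat : ∀ i j k : ℕ+, i < j →
    toEquiv.symm (toEquiv i + toEquiv k) < toEquiv.symm (toEquiv j + toEquiv k)

open Classical in
noncomputable def bcoef {d : ℕ} (a : (Fin d → ℕ) → ℂ) (c : ℕ) (n m : Fin d → ℕ) : ℂ :=
  if n ≤ m ∧ m - n ∈ Mfin d c then a (m - n) else 0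

noncomputable def hIdx {d : ℕ} (a : (Fin d → ℕ) → ℂ) (c p : ℕ) (ν : GradedOrdering d)
    (i : ℕ+) : ℕ+ :=
  (sSup {l : ℕ | 0 < l ∧ l ≤ Nc d p ∧
    bcoef a c (ν.toEquiv i) (ν.toEquiv l.toPNat') ≠ 0}).toPNat'

def barSet {d : ℕ} (a : (Fin d → ℕ) → ℂ) (c p : ℕ) (ν : GradedOrdering d) : Set ℕ+ :=
  {l | ∃ i : ℕ+, (i : ℕ) ≤ Nc d (p - c) ∧ hIdx a c p ν i = l}

open Classical in
noncomputable def Jfin {d : ℕ} (a : (Fin d → ℕ) → ℂ) (c p : ℕ) (ν : GradedOrdering d) :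
    Finset ℕ+ :=
  ((Finset.range (Nc d p)).filter fun l => l.succPNat ∉ barSet a c p ν).image Nat.succPNat

noncomputable def Pbar {d : ℕ} (a : (Fin d → ℕ) → ℂ) (c p : ℕ) (ν : GradedOrdering d) :
    Matrix (Fin (Nc d (p - c))) (Fin (Nc d (p - c))) ℂ :=
  Matrix.of fun i j =>
    bcoef a c (ν.toEquiv i.val.succPNat) (ν.toEquiv (hIdx a c p ν j.val.succPNat))

open Classical in
noncomputable def Mdec {d : ℕ} (a : (Fin d → ℕ) → ℂ) (c p : ℕ) (ν : GradedOrdering d)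
    (i s : ℕ+) : ℂ :=
  if hr : ∃ r : Fin (Nc d (p - c)), hIdx a c p ν r.val.succPNat = i then
    -∑ r₂ : Fin (Nc d (p - c)), (Pbar a c p ν)⁻¹ hr.choose r₂ *
      bcoef a c (ν.toEquiv r₂.val.succPNat) (ν.toEquiv s)
  else if i = s then (1 : ℂ) else 0

noncomputable def pderiv' {d : ℕ} (i : Fin d) (f : (Fin d → ℝ) → ℂ) : (Fin d → ℝ) → ℂ :=
  fun x => fderiv ℝ f x (Pi.single i 1)

noncomputable def mderiv {d : ℕ} (m : Fin d → ℕ) (f : (Fin d → ℝ) → ℂ) :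
    (Fin d → ℝ) → ℂ :=
  (List.finRange d).foldr (fun i g => (pderiv' i)^[m i] g) f

open Classical in
noncomputable def Tmat {d : ℕ} (ν : GradedOrdering d) (hv : Fin d → ℝ) (n i : ℕ+) : ℂ :=
  if ν.toEquiv i ≤ ν.toEquiv n then
    ∏ k, (((hv k : ℝ) : ℂ) ^ ((ν.toEquiv n - ν.toEquiv i) k) /
      (((ν.toEquiv n - ν.toEquiv i) k).factorial : ℂ))
  else 0

noncomputable def alphaVec {d : ℕ} (ν : GradedOrdering d) (y c₁ : Fin d → ℝ) (n : ℕ+) : ℂ :=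
  ∏ k, (((c₁ k - y k : ℝ) : ℂ) ^ (ν.toEquiv n k) / ((ν.toEquiv n k).factorial : ℂ))

theorem mem_Mfin {d t : ℕ} {q : Fin d → ℕ} : q ∈ Mfin d t ↔ ∑ i, q i ≤ t := by
  simp only [Mfin, Finset.mem_filter, Fintype.mem_piFinset, Finset.mem_range, and_iff_right_iff_imp]
  exact fun h i => Nat.lt_succ_of_le
    ((Finset.single_le_sum (fun j _ => Nat.zero_le (q j)) (Finset.mem_univ i)).trans h)

/-- A graded ordering enumerates the multi-indices of degree at most `t` by the first
`Nc d t` positive integers. -/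
theorem GradedOrdering.le_Nc_iff {d : ℕ} (ν : GradedOrdering d) (t : ℕ) (i : ℕ+) :
    (i : ℕ) ≤ Nc d t ↔ ∑ s, ν.toEquiv i s ≤ t := by
  have hmem (l : ℕ+) :
      l ∈ (Mfin d t).map ν.toEquiv.symm.toEmbedding ↔ ∑ s, ν.toEquiv l s ≤ t := by
    rw [Finset.mem_map_equiv, Equiv.symm_symm, mem_Mfin]
  have hmono {l l' : ℕ+} (h : l ≤ l') : ∑ s, ν.toEquiv l s ≤ ∑ s, ν.toEquiv l' s :=
    le_of_not_gt fun h' => (ν.graded _ _ h').not_ge h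
  have hcard : ((Mfin d t).map ν.toEquiv.symm.toEmbedding).card = Nc d t := Finset.card_map _
  rw [← hcard]
  constructor
  · intro h
    by_contra hi
    have hsub : (Mfin d t).map ν.toEquiv.symm.toEmbedding ⊆ Finset.Ico 1 i := by
      intro l hl
      rw [Finset.mem_Ico]
      refine ⟨one_le, lt_of_not_ge fun hil => hi ?_⟩
      exact (hmono hil).trans ((hmem l).1 hl)
    have hle := Finset.card_le_card hsub
    rw [PNat.card_Ico] at hle
    have := i.pos
    simp only [PNat.one_coe] at hle
    omega
  · intro h
    have hsub : Finset.Icc 1 i ⊆ (Mfin d t).map ν.toEquiv.symm.toEmbedding := by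
      intro l hl
      exact (hmem l).2 ((hmono (Finset.mem_Icc.1 hl).2).trans h)
    have hle := Finset.card_le_card hsub
    rw [PNat.card_Icc] at hle
    simpa using hle

theorem sum_ite_eq_const {d : ℕ} (k : Fin d) (c : ℕ) :
    ∑ t : Fin d, (if t = k then c else 0) = c := by simp

theorem eq_ite_of_sum_le {d c : ℕ} {k : Fin d} {q : Fin d → ℕ} (hsum : ∑ t, q t ≤ c)
    (hk : c ≤ q k) : q = fun t => if t = k then c else 0 := by
  have hsplit := Finset.add_sum_erase Finset.univ q (Finset.mem_univ k)
  funext t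
  by_cases htk : t = k
  · subst htk
    simp only [if_true]
    omega
  · have := Finset.single_le_sum (f := q) (fun j _ => Nat.zero_le (q j))
      (Finset.mem_erase.2 ⟨htk, Finset.mem_univ t⟩)
    simp only [htk, if_false]
    omega

theorem toEquiv_hIdx {d p c : ℕ} (hpc : c ≤ p) (k : Fin d) (a : (Fin d → ℕ) → ℂ)
    (hak : a (fun t => if t = k then c else 0) ≠ 0) (ν : GradedOrdering d)
    (hlex : ∀ i j : ℕ+, (∑ t, ν.toEquiv i t) = (∑ t, ν.toEquiv j t) →
      ν.toEquiv i k < ν.toEquiv j k → i < j)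
    (i : ℕ+) (hi : ∑ t, ν.toEquiv i t ≤ p - c) :
    ν.toEquiv (hIdx a c p ν i) = ν.toEquiv i + fun t => if t = k then c else 0 := by
  obtain ⟨L, hL⟩ := ν.toEquiv.surjective (ν.toEquiv i + fun t => if t = k then c else 0)
  have hLsum : ∑ t, ν.toEquiv L t = (∑ t, ν.toEquiv i t) + c := by
    rw [hL]
    simp only [Pi.add_apply, Finset.sum_add_distrib, sum_ite_eq_const]
  have hgreatest : IsGreatest {l : ℕ | 0 < l ∧ l ≤ Nc d p ∧
      bcoef a c (ν.toEquiv i) (ν.toEquiv l.toPNat') ≠ 0} (L : ℕ) := by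
    constructor
    · refine ⟨L.pos, (ν.le_Nc_iff p L).2 (by omega), ?_⟩
      rw [PNat.coe_toPNat', hL, bcoef, add_tsub_cancel_left, if_pos]
      · exact hak
      · exact ⟨le_self_add, mem_Mfin.2 (sum_ite_eq_const k c).le⟩
    · rintro l ⟨hl, -, hb⟩
      lift l to ℕ+ using hl
      rw [PNat.coe_toPNat', bcoef] at hb
      have hcond : ν.toEquiv i ≤ ν.toEquiv l ∧ ν.toEquiv l - ν.toEquiv i ∈ Mfin d c := by
        by_contra h
        exact hb (if_neg h)
      obtain ⟨q, hq⟩ := exists_add_of_le hcond.1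
      have hqc : ∑ t, q t ≤ c := by
        simpa [hq, mem_Mfin] using hcond.2
      have hlsum : ∑ t, ν.toEquiv l t = (∑ t, ν.toEquiv i t) + ∑ t, q t := by
        rw [hq]
        simp only [Pi.add_apply, Finset.sum_add_distrib]
      rw [PNat.coe_le_coe]
      rcases hqc.lt_or_eq with hlt | heq
      · exact (ν.graded l L (by omega)).le
      · by_cases hqk : c ≤ q k
        · rw [eq_ite_of_sum_le hqc hqk, ← hL] at hq
          exact (ν.toEquiv.injective hq).le
        · refine (hlex l L (by omega) ?_).le
          rw [hq, hL]
          simp only [Pi.add_apply, if_true]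
          omega
  rw [hIdx, hgreatest.csSup_eq, PNat.coe_toPNat', hL]

/-- Suppose `a_{c·e_k} ≠ 0` and `ν` is a graded (lexicographic) monomial
ordering in which, within equal total degree, the `k`-th coordinate varies slowest (is most
significant).  Then `ν(h(1)) = c·e_k`; the set of unrepresented multi-indices
`{ν(h(1)),…,ν(h(N(p−c)))}` equals `{m ∈ M(p) : m_k ≥ c}`; and every represented index
`s ∈ j` satisfies `ν(s)_k ≤ c − 1`. -/
theorem gradedLex_unrepresented {d p c : ℕ} (hd : 1 ≤ d) (hc : 1 ≤ c) (hpc : c ≤ p)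
    (k : Fin d) (a : (Fin d → ℕ) → ℂ)
    (hak : a (fun t => if t = k then c else 0) ≠ 0)
    (ν : GradedOrdering d)
    (hlex : ∀ i j : ℕ+, (∑ t, ν.toEquiv i t) = (∑ t, ν.toEquiv j t) →
      ν.toEquiv i k < ν.toEquiv j k → i < j) :
    ν.toEquiv (hIdx a c p ν 1) = (fun t => if t = k then c else 0)
    ∧ {m : Fin d → ℕ | ∃ i : ℕ+, (i : ℕ) ≤ Nc d (p - c) ∧ ν.toEquiv (hIdx a c p ν i) = m}
        = {m : Fin d → ℕ | m ∈ Mfin d p ∧ c ≤ m k}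
    ∧ ∀ s ∈ Jfin a c p ν, ν.toEquiv s k ≤ c - 1 := by
  have hidx := toEquiv_hIdx hpc k a hak ν hlex
  have hset : {m : Fin d → ℕ | ∃ i : ℕ+, (i : ℕ) ≤ Nc d (p - c) ∧
      ν.toEquiv (hIdx a c p ν i) = m} = {m : Fin d → ℕ | m ∈ Mfin d p ∧ c ≤ m k} := by
    ext m
    simp only [Set.mem_ofPred_eq, mem_Mfin]
    constructor
    · rintro ⟨i, hi, rfl⟩
      rw [ν.le_Nc_iff] at hi
      rw [hidx i hi]
      simp only [Pi.add_apply, Finset.sum_add_distrib, sum_ite_eq_const, if_true]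
      omega
    · rintro ⟨hm, hmk⟩
      have hle : (fun t => if t = k then c else 0) ≤ m := by
        intro t
        dsimp only
        split_ifs with h
        · exact h ▸ hmk
        · exact Nat.zero_le _
      obtain ⟨n, rfl⟩ := exists_add_of_le hle
      obtain ⟨i, rfl⟩ := ν.toEquiv.surjective n
      simp only [Pi.add_apply, Finset.sum_add_distrib, sum_ite_eq_const] at hm
      have hi : ∑ t, ν.toEquiv i t ≤ p - c := by omega
      exact ⟨i, (ν.le_Nc_iff _ i).2 hi, by rw [hidx i hi, add_comm]⟩
  refine ⟨?_, hset, ?_⟩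
  · rw [hidx 1 (by simp [ν.map_one]), ν.map_one, zero_add]
  · intro s hs
    simp only [Jfin, Finset.mem_image, Finset.mem_filter, Finset.mem_range] at hs
    obtain ⟨l, ⟨hl, hbar⟩, rfl⟩ := hs
    by_contra hk
    have hdeg : ∑ t, ν.toEquiv l.succPNat t ≤ p := (ν.le_Nc_iff p _).1 hl
    have hmem : ν.toEquiv l.succPNat ∈ {m : Fin d → ℕ | m ∈ Mfin d p ∧ c ≤ m k} :=
      ⟨mem_Mfin.2 hdeg, by omega⟩
    rw [← hset] at hmem
    obtain ⟨i, hi, heq⟩ := hmem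
    exact hbar ⟨i, hi, ν.toEquiv.injective heq⟩
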